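/- Convergence of the aggregate dual consensus ADMM (Proposition 1). Let ρ > 0 and let initial values y_i^0 ∈ ℝ^m and p_i^0 = 0 be given for each i ∈ 𝒩. Suppose the sequences (p_i^k), (r_i^k), (x_i^k, t_i^k), (y_i^k) satisfy, for every k ≥ 0 and every i ∈ 𝒩: p_i^{k+1} = p_i^k + ρ ∑_{j∈𝒩_i} (y_i^k − y_j^k); r_i^{k+1} = ρ ∑_{j∈𝒩_i} (y_i^k + y_j^k) − (b_i + p_i^{k+1}); (x_i^{k+1}, t_i^{k+1}) is a global minimizer over (x_i, t_i) ∈ ℝ^{n_i} × K of f_i(x_i) + (1/(4 ρ d_i)) ‖A_i x_i + r_i^{k+1} − t_i‖²; and y_i^{k+1} = (1/(2 ρ d_i)) Π_{K∘}(A_i x_i^{k+1} + r_i^{k+1}). Then there exists y* maximizing the dual problem (D) such that y_i^k → y* as k → ∞ for every i ∈ 𝒩, and every limit point of the sequence of concatenated vectors ((x_i^k)_{i∈𝒩})_{k∈ℕ} in ℝ^n is a minimizer of the primal problem (P). -/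

import Mathlib

open Filter Topology RealInnerProductSpace

open Classical in
/-- Euclidean projection onto a set (well-defined on nonempty closed convex sets). -/
noncomputable def projSet {E : Type*} [NormedAddCommGroup E] [InnerProductSpace ℝ E]
    (C : Set E) (z : E) : E :=
  if h : ∃ p ∈ C, ∀ q ∈ C, ‖z - p‖ ≤ ‖z - q‖ then h.choose else z

/-- Polar cone of a set. -/
def polarSet {E : Type*} [NormedAddCommGroup E] [InnerProductSpace ℝ E] (C : Set E) : Set E :=
  {y | ∀ x ∈ C, ⟪x, y⟫ ≤ 0}

/-- Normal cone of a convex set `C` at a point `x`. -/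
def nCone {E : Type*} [NormedAddCommGroup E] [InnerProductSpace ℝ E]
    (C : Set E) (x : E) : Set E :=
  {u | ∀ w ∈ C, ⟪u, w - x⟫ ≤ 0}

/-- Convex (Fenchel) conjugate of an extended-real-valued function. -/
noncomputable def econj {E : Type*} [NormedAddCommGroup E] [InnerProductSpace ℝ E]
    (f : E → EReal) (y : E) : EReal :=
  ⨆ x, ((⟪y, x⟫ : ℝ) : EReal) - f x

open Classical in
/-- Extended-real-valued indicator function of a set. -/
noncomputable def eindicator {E : Type*} (C : Set E) (y : E) : EReal :=
  if y ∈ C then 0 else ⊤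

/-- Subdifferential of an extended-real-valued function. -/
def ESubdiff {E : Type*} [NormedAddCommGroup E] [InnerProductSpace ℝ E]
    (f : E → EReal) (x : E) : Set E :=
  {u | ∀ v, f x + ((⟪u, v - x⟫ : ℝ) : EReal) ≤ f v}

/-- Convexity of an extended-real-valued function. -/
def EConvexFn {E : Type*} [AddCommMonoid E] [Module ℝ E] (f : E → EReal) : Prop :=
  ∀ x y : E, ∀ a b : ℝ, 0 ≤ a → 0 ≤ b → a + b = 1 →
    f (a • x + b • y) ≤ (a : EReal) * f x + (b : EReal) * f y

/-- Properness of an extended-real-valued function. -/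
def EProper {E : Type*} (f : E → EReal) : Prop :=
  (∀ x, f x ≠ ⊥) ∧ ∃ x, f x ≠ ⊤

section Abstract

variable {H : Type*} [NormedAddCommGroup H] [InnerProductSpace ℝ H]

theorem norm_sq_le_of_symmetric_nonneg (L : H →L[ℝ] H)
    (hsymm : ∀ a b, ⟪L a, b⟫ = ⟪a, L b⟫) (hpos : ∀ a, 0 ≤ ⟪L a, a⟫) (a : H) :
    ‖L a‖ ^ 2 ≤ (‖L‖ + 1) * ⟪L a, a⟫ := by
  set c := ‖L‖ + 1 with hc
  have hc0 : 0 < c := by positivity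
  have h1 := hpos (a - c⁻¹ • L a)
  have h2 : ⟪L (L a), L a⟫ ≤ c * ‖L a‖ ^ 2 := by
    calc ⟪L (L a), L a⟫ ≤ ‖L (L a)‖ * ‖L a‖ := real_inner_le_norm _ _
      _ ≤ (‖L‖ * ‖L a‖) * ‖L a‖ := by gcongr; exact L.le_opNorm _
      _ ≤ c * ‖L a‖ ^ 2 := by rw [hc]; nlinarith [sq_nonneg ‖L a‖]
  simp only [map_sub, map_smul, inner_sub_left, inner_sub_right, inner_smul_left,
    inner_smul_right, RCLike.conj_to_real, hsymm (L a) a, real_inner_self_eq_norm_sq] at h1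
  have h3 : c⁻¹ * (c⁻¹ * ⟪L (L a), L a⟫) ≤ c⁻¹ * (c⁻¹ * (c * ‖L a‖ ^ 2)) := by gcongr
  have h4 : c⁻¹ * (c⁻¹ * (c * ‖L a‖ ^ 2)) = c⁻¹ * ‖L a‖ ^ 2 := by field_simp
  have h5 : c⁻¹ * ‖L a‖ ^ 2 ≤ ⟪L a, a⟫ := by linarith
  rwa [inv_mul_le_iff₀ hc0] at h5

theorem exists_inner_le_norm_sq [FiniteDimensional ℝ H] (L : H →L[ℝ] H)
    (hsymm : ∀ a b, ⟪L a, b⟫ = ⟪a, L b⟫) :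
    ∃ C : ℝ, ∀ a, ⟪L a, a⟫ ≤ C * ‖L a‖ ^ 2 := by
  obtain ⟨g, hg⟩ := (L : H →ₗ[ℝ] H).rangeRestrict.exists_rightInverse_of_surjective
    (LinearMap.range_rangeRestrict _)
  have hg' : ∀ a, L (g ((L : H →ₗ[ℝ] H).rangeRestrict a)) = L a := fun a => by
    have := LinearMap.congr_fun hg ((L : H →ₗ[ℝ] H).rangeRestrict a)
    simpa using congrArg Subtype.val this
  refine ⟨‖LinearMap.toContinuousLinearMap g‖, fun a => ?_⟩
  set b := (L : H →ₗ[ℝ] H).rangeRestrict a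
  have hb : ‖b‖ = ‖L a‖ := rfl
  have h1 : ‖g b‖ ≤ ‖LinearMap.toContinuousLinearMap g‖ * ‖b‖ :=
    (LinearMap.toContinuousLinearMap g).le_opNorm b
  have h2 : ⟪L a, a⟫ = ⟪L a, g b⟫ := by
    rw [hsymm a (g b), hg' a, hsymm]
  calc ⟪L a, a⟫ = ⟪L a, g b⟫ := h2
    _ ≤ ‖L a‖ * ‖g b‖ := real_inner_le_norm _ _
    _ ≤ ‖L a‖ * (‖LinearMap.toContinuousLinearMap g‖ * ‖b‖) := by gcongr
    _ = _ := by rw [hb]; ring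

/-- One-step decrease of the Lyapunov function of the primal-dual iteration. -/
theorem lyapunov_decrease (L Q : H →L[ℝ] H)
    (hL : ∀ a b, ⟪L a, b⟫ = ⟪a, L b⟫) (hQ : ∀ a b, ⟪Q a, b⟫ = ⟪a, Q b⟫)
    {y y' s u yr sr : H} (hyr : L yr = 0)
    (hu : u + L (s + y') + Q (y' - y) = 0) (hmono : 0 ≤ ⟪u + L sr, y' - yr⟫) :
    (⟪L (s + y' - sr), s + y' - sr⟫ + ⟪Q (y' - yr), y' - yr⟫)
      + ⟪L (y' - yr), y' - yr⟫ + ⟪Q (y' - y), y' - y⟫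
      ≤ ⟪L (s - sr), s - sr⟫ + ⟪Q (y - yr), y - yr⟫ := by
  have e1 : u + L sr = -(L (s - sr + (y' - yr))) - Q ((y' - yr) - (y - yr)) := by
    have : u = -(L (s + y')) - Q (y' - y) := by
      rw [← sub_eq_zero, ← hu]; abel
    rw [this]; simp only [map_add, map_sub, hyr]; abel
  have e2 : ⟪L (s + y' - sr), s + y' - sr⟫
      = ⟪L (s - sr + (y' - yr)), s - sr + (y' - yr)⟫ := by
    have : s + y' - sr = (s - sr + (y' - yr)) + yr := by abel
    rw [this, map_add, hyr, add_zero, inner_add_right, hL _ yr, hyr, inner_zero_right, add_zero]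
  have e3 : y' - y = (y' - yr) - (y - yr) := by abel
  rw [e1] at hmono
  rw [e2, e3]
  generalize y' - yr = z' at *
  generalize y - yr = z at *
  generalize s - sr = a at *
  simp only [map_add, map_sub, inner_add_left, inner_add_right, inner_sub_left, inner_sub_right,
    inner_neg_left] at hmono ⊢
  have c1 : ⟪L z', a⟫ = ⟪L a, z'⟫ := by rw [hL, real_inner_comm]
  have c2 : ⟪Q z', z⟫ = ⟪Q z, z'⟫ := by rw [hQ, real_inner_comm]
  linarith

theorem lyapunov_convergence [FiniteDimensional ℝ H] (L Q : H →L[ℝ] H)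
    (hL : ∀ a b, ⟪L a, b⟫ = ⟪a, L b⟫) (hQ : ∀ a b, ⟪Q a, b⟫ = ⟪a, Q b⟫)
    (hL0 : ∀ a, 0 ≤ ⟪L a, a⟫) (hQ0 : ∀ a, 0 ≤ ⟪Q a, a⟫)
    {c : ℝ} (hc : 0 < c) (hco : ∀ a, c * ‖a‖ ^ 2 ≤ ⟪L a, a⟫ + ⟪Q a, a⟫)
    (Y S U : ℕ → H) (hS : ∀ k, S (k + 1) = S k + Y k)
    (hU : ∀ k, U k + L (S (k + 2)) + Q (Y (k + 1) - Y k) = 0)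
    (hmono : ∀ k l, 0 ≤ ⟪U k - U l, Y (k + 1) - Y (l + 1)⟫)
    (yr sr : H) (hyr : L yr = 0) (href : ∀ k, 0 ≤ ⟪U k + L sr, Y (k + 1) - yr⟫) :
    ∃ y s : H, L y = 0 ∧ Tendsto Y atTop (𝓝 y) ∧ Tendsto U atTop (𝓝 (-(L s))) := by
  -- consequences of the Lyapunov decrease, for an arbitrary reference point
  have key : ∀ yr sr : H, L yr = 0 → (∀ k, 0 ≤ ⟪U k + L sr, Y (k + 1) - yr⟫) →
      ∃ V : ℕ → ℝ, (∀ k, V k = ⟪L (S (k + 1) - sr), S (k + 1) - sr⟫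
          + ⟪Q (Y k - yr), Y k - yr⟫) ∧ Antitone V ∧
        (∀ k, ⟪L (S (k + 1) - sr), S (k + 1) - sr⟫ ≤ V k) ∧
        (∀ k, c * ‖Y (k + 1) - yr‖ ^ 2 ≤ V k) ∧
        Tendsto (fun k => ⟪L (Y (k + 1) - yr), Y (k + 1) - yr⟫) atTop (𝓝 0) ∧
        Tendsto (fun k => ⟪Q (Y (k + 1) - Y k), Y (k + 1) - Y k⟫) atTop (𝓝 0) := by
    intro yr sr hyr href
    set V : ℕ → ℝ := fun k => ⟪L (S (k + 1) - sr), S (k + 1) - sr⟫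
          + ⟪Q (Y k - yr), Y k - yr⟫ with hV
    have hdec : ∀ k, V (k + 1) + ⟪L (Y (k + 1) - yr), Y (k + 1) - yr⟫
        + ⟪Q (Y (k + 1) - Y k), Y (k + 1) - Y k⟫ ≤ V k := by
      intro k
      have h := hU k
      rw [hS (k + 1)] at h
      have := lyapunov_decrease L Q hL hQ hyr h (href k)
      simpa only [hV, hS (k + 1)] using this
    have hanti : Antitone V := antitone_nat_of_succ_le fun k => by
      linarith [hdec k, hL0 (Y (k + 1) - yr), hQ0 (Y (k + 1) - Y k)]
    have hV0 : ∀ k, 0 ≤ V k := fun k => add_nonneg (hL0 _) (hQ0 _)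
    have hlim := tendsto_atTop_ciInf hanti ⟨0, by rintro _ ⟨k, rfl⟩; exact hV0 k⟩
    have hdiff : Tendsto (fun k => V k - V (k + 1)) atTop (𝓝 0) := by
      simpa using hlim.sub ((tendsto_add_atTop_iff_nat 1).2 hlim)
    refine ⟨V, fun _ => rfl, hanti, fun k => ?_, fun k => ?_, ?_, ?_⟩
    · exact le_add_of_nonneg_right (hQ0 _)
    · have h1 := hco (Y (k + 1) - yr)
      have h2 := hL0 (S (k + 2) - sr)
      have h3 : V (k + 1) = ⟪L (S (k + 2) - sr), S (k + 2) - sr⟫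
          + ⟪Q (Y (k + 1) - yr), Y (k + 1) - yr⟫ := rfl
      linarith [hdec k, hQ0 (Y (k + 1) - Y k)]
    · refine squeeze_zero (fun k => hL0 _) (fun k => ?_) hdiff
      linarith [hdec k, hQ0 (Y (k + 1) - Y k)]
    · refine squeeze_zero (fun k => hQ0 _) (fun k => ?_) hdiff
      linarith [hdec k, hL0 (Y (k + 1) - yr)]
  have hLn := norm_sq_le_of_symmetric_nonneg L hL hL0
  have hQn := norm_sq_le_of_symmetric_nonneg Q hQ hQ0
  have tend_of_sq : ∀ w : ℕ → H, Tendsto (fun k => ‖w k‖ ^ 2) atTop (𝓝 0) →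
      Tendsto w atTop (𝓝 0) := by
    intro w hw
    rw [tendsto_zero_iff_norm_tendsto_zero]
    simpa [Real.sqrt_sq] using hw.sqrt
  obtain ⟨V, hVdef, hVanti, hVS, hVY, hLY, hQY⟩ := key yr sr hyr href
  have hLY' : Tendsto (fun k => L (Y (k + 1))) atTop (𝓝 0) := by
    refine tend_of_sq _ (squeeze_zero (fun _ => sq_nonneg _) (fun k => ?_)
      (by simpa only [mul_zero] using hLY.const_mul (‖L‖ + 1)))
    have := hLn (Y (k + 1) - yr)
    rwa [show L (Y (k + 1) - yr) = L (Y (k + 1)) by rw [map_sub, hyr, sub_zero]] at this ⊢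
  have hQY' : Tendsto (fun k => Q (Y (k + 1) - Y k)) atTop (𝓝 0) :=
    tend_of_sq _ (squeeze_zero (fun _ => sq_nonneg _) (fun k => hQn _)
      (by simpa using hQY.const_mul (‖Q‖ + 1)))
  have hUeq : ∀ k, U k = -L (S (k + 2)) - Q (Y (k + 1) - Y k) := fun k => by
    rw [← sub_eq_zero, ← hU k]; abel
  -- a cluster point of the iterates
  have hYb : ∀ k, ‖Y (k + 1)‖ ≤ ‖yr‖ + (c⁻¹ * V 0 + 1) := fun k => by
    have h1 : ‖Y (k + 1) - yr‖ ^ 2 ≤ c⁻¹ * V 0 := by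
      rw [le_inv_mul_iff₀ hc]; exact (hVY k).trans (hVanti (Nat.zero_le k))
    have h2 : ‖Y (k + 1)‖ ≤ ‖yr‖ + ‖Y (k + 1) - yr‖ := norm_le_norm_add_norm_sub' _ _
    nlinarith [sq_nonneg (‖Y (k + 1) - yr‖ - 1), norm_nonneg (Y (k + 1) - yr)]
  have hSb : ∀ k, ‖L (S (k + 2))‖ ≤ ‖L sr‖ + ((‖L‖ + 1) * V 0 + 1) := fun k => by
    have h1 : ‖L (S (k + 2) - sr)‖ ^ 2 ≤ (‖L‖ + 1) * V 0 :=
      (hLn _).trans (by gcongr; exact (hVS (k + 1)).trans (hVanti (Nat.zero_le _)))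
    have h2 : ‖L (S (k + 2))‖ ≤ ‖L sr‖ + ‖L (S (k + 2)) - L sr‖ := norm_le_norm_add_norm_sub' _ _
    rw [← map_sub] at h2
    nlinarith [sq_nonneg (‖L (S (k + 2) - sr)‖ - 1), norm_nonneg (L (S (k + 2) - sr))]
  obtain ⟨⟨y, q⟩, -, φ, hφ, hlim⟩ := tendsto_subseq_of_bounded
    (s := Metric.closedBall (0 : H) (‖yr‖ + (c⁻¹ * V 0 + 1)) ×ˢ
      Metric.closedBall (0 : H) (‖L sr‖ + ((‖L‖ + 1) * V 0 + 1)))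
    (Metric.isBounded_closedBall.prod Metric.isBounded_closedBall)
    (x := fun k => (Y (k + 1), L (S (k + 2))))
    (fun k => ⟨by simpa using hYb k, by simpa using hSb k⟩)
  have hY1 : Tendsto (fun k => Y (φ k + 1)) atTop (𝓝 y) := (continuous_fst.tendsto _).comp hlim
  have hS1 : Tendsto (fun k => L (S (φ k + 2))) atTop (𝓝 q) := (continuous_snd.tendsto _).comp hlim
  have hLy : L y = 0 := tendsto_nhds_unique ((L.continuous.tendsto y).comp hY1)
    (hLY'.comp hφ.tendsto_atTop)
  obtain ⟨s, rfl⟩ : ∃ s, L s = q := by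
    have hcl : IsClosed ((L : H →ₗ[ℝ] H).range : Set H) := Submodule.closed_of_finiteDimensional _
    exact hcl.mem_of_tendsto hS1 (Eventually.of_forall fun k => ⟨S (φ k + 2), rfl⟩)
  have hU1 : Tendsto (fun k => U (φ k)) atTop (𝓝 (-(L s))) := by
    simp only [hUeq]
    simpa using hS1.neg.sub (hQY'.comp hφ.tendsto_atTop)
  have href' : ∀ k, 0 ≤ ⟪U k + L s, Y (k + 1) - y⟫ := fun k => by
    have h : Tendsto (fun l => ⟪U k - U (φ l), Y (k + 1) - Y (φ l + 1)⟫) atTop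
        (𝓝 ⟪U k - (-(L s)), Y (k + 1) - y⟫) :=
      (tendsto_const_nhds.sub hU1).inner (tendsto_const_nhds.sub hY1)
    rw [sub_neg_eq_add] at h
    exact ge_of_tendsto' h fun l => hmono _ _
  obtain ⟨W, hWdef, hWanti, hWS, hWY, -, -⟩ := key y s hLy href'
  obtain ⟨C, hC⟩ := exists_inner_le_norm_sq L hL
  have hW1 : Tendsto (fun k => W (φ k + 1)) atTop (𝓝 0) := by
    have h1 : Tendsto (fun k => C * ‖L (S (φ k + 2)) - L s‖ ^ 2
        + ⟪Q (Y (φ k + 1) - y), Y (φ k + 1) - y⟫) atTop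
        (𝓝 (C * ‖L s - L s‖ ^ 2 + ⟪Q (y - y), y - y⟫)) :=
      (((hS1.sub_const _).norm.pow 2).const_mul C).add
        (((Q.continuous.tendsto _).comp (hY1.sub_const y)).inner (hY1.sub_const y))
    simp only [sub_self, norm_zero, map_zero, inner_zero_left] at h1
    rw [show C * 0 ^ 2 + 0 = (0 : ℝ) by ring] at h1
    refine squeeze_zero (fun k => ?_) (fun k => ?_) h1
    · rw [hWdef]; exact add_nonneg (hL0 _) (hQ0 _)
    · rw [hWdef, ← map_sub L]
      gcongr
      exact hC _
  have hW : Tendsto W atTop (𝓝 0) := by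
    have hlimW := tendsto_atTop_ciInf hWanti ⟨0, by
      rintro _ ⟨k, rfl⟩; rw [hWdef]; exact add_nonneg (hL0 _) (hQ0 _)⟩
    have h2 := hlimW.comp ((tendsto_add_atTop_nat 1).comp hφ.tendsto_atTop)
    rwa [tendsto_nhds_unique h2 hW1] at hlimW
  refine ⟨y, s, hLy, ?_, ?_⟩
  · rw [← tendsto_add_atTop_iff_nat 1, ← tendsto_sub_nhds_zero_iff]
    refine tend_of_sq _ (squeeze_zero (fun _ => sq_nonneg _) (fun k => ?_)
      (by simpa using hW.const_mul c⁻¹))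
    rw [le_inv_mul_iff₀ hc]
    exact hWY k
  · have hS2 : Tendsto (fun k => L (S (k + 2))) atTop (𝓝 (L s)) := by
      rw [← tendsto_sub_nhds_zero_iff]
      refine tend_of_sq _ (squeeze_zero (fun _ => sq_nonneg _) (fun k => ?_)
        (by simpa using ((tendsto_add_atTop_iff_nat 1).2 hW).const_mul (‖L‖ + 1)))
      rw [← map_sub]
      refine (hLn _).trans ?_
      gcongr
      exact hWS (k + 1)
    have := hS2.neg.sub hQY'
    simp only [← hUeq, sub_zero] at this
    exact this

end Abstract

section Graph

variable {N : Type*} [Fintype N] (G : SimpleGraph N) [DecidableRel G.Adj]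

/-- The graph Laplacian (`ε = -1`) or signless Laplacian (`ε = 1`), scaled by `ρ`, acting on
vector-valued functions on the vertices. -/
noncomputable def signedLaplacian (E : Type*) [NormedAddCommGroup E] [InnerProductSpace ℝ E]
    [FiniteDimensional ℝ E] (ρ ε : ℝ) :
    PiLp 2 (fun _ : N => E) →L[ℝ] PiLp 2 (fun _ : N => E) :=
  LinearMap.toContinuousLinearMap
    { toFun := fun z => WithLp.toLp 2 fun i => ρ • ∑ j ∈ G.neighborFinset i, (z i + ε • z j)
      map_add' := fun z w => by
        ext i
        simp only [PiLp.add_apply, ← smul_add, ← Finset.sum_add_distrib]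
        congr 1
        exact Finset.sum_congr rfl fun j _ => by rw [smul_add]; abel
      map_smul' := fun a z => by
        ext i
        simp only [PiLp.smul_apply, RingHom.id_apply]
        rw [smul_comm a ρ]
        simp only [Finset.smul_sum, smul_add, smul_comm ε a] }

theorem SimpleGraph.sum_neighborFinset_comm (F : N → N → ℝ) :
    ∑ i, ∑ j ∈ G.neighborFinset i, F i j = ∑ i, ∑ j ∈ G.neighborFinset i, F j i :=
  Finset.sum_comm' fun i j => by simp [G.adj_comm]

variable {E : Type*} [NormedAddCommGroup E] [InnerProductSpace ℝ E] [FiniteDimensional ℝ E]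

theorem signedLaplacian_apply (ρ ε : ℝ) (z : PiLp 2 (fun _ : N => E)) (i : N) :
    signedLaplacian G E ρ ε z i = ρ • ∑ j ∈ G.neighborFinset i, (z i + ε • z j) := rfl

theorem inner_signedLaplacian (ρ : ℝ) {ε : ℝ} (hε : ε * ε = 1)
    (z w : PiLp 2 (fun _ : N => E)) :
    ⟪signedLaplacian G E ρ ε z, w⟫
      = ρ / 2 * ∑ i, ∑ j ∈ G.neighborFinset i, ⟪z i + ε • z j, w i + ε • w j⟫ := by
  have h1 : ⟪signedLaplacian G E ρ ε z, w⟫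
      = ρ * ∑ i, ∑ j ∈ G.neighborFinset i, ⟪z i + ε • z j, w i⟫ := by
    rw [PiLp.inner_apply, Finset.mul_sum]
    refine Finset.sum_congr rfl fun i _ => ?_
    rw [signedLaplacian_apply, real_inner_smul_left, sum_inner]
  have h2 : ∑ i, ∑ j ∈ G.neighborFinset i, ⟪z i + ε • z j, w i + ε • w j⟫
      = 2 * ∑ i, ∑ j ∈ G.neighborFinset i, ⟪z i + ε • z j, w i⟫ := by
    rw [two_mul]
    conv_rhs => rw [G.sum_neighborFinset_comm (fun i j => ⟪z i + ε • z j, w i⟫)]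
    conv_rhs => arg 1; rw [← G.sum_neighborFinset_comm (fun i j => ⟪z i + ε • z j, w i⟫)]
    simp only [← Finset.sum_add_distrib]
    refine Finset.sum_congr rfl fun i _ => Finset.sum_congr rfl fun j _ => ?_
    simp only [inner_add_left, inner_add_right, real_inner_smul_left, real_inner_smul_right]
    linear_combination ⟪z j, w j⟫ * hε
  rw [h1, h2]; ring

theorem signedLaplacian_symm (ρ : ℝ) {ε : ℝ} (hε : ε * ε = 1)
    (z w : PiLp 2 (fun _ : N => E)) :
    ⟪signedLaplacian G E ρ ε z, w⟫ = ⟪z, signedLaplacian G E ρ ε w⟫ := by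
  rw [real_inner_comm (signedLaplacian G E ρ ε w) z, inner_signedLaplacian G ρ hε,
    inner_signedLaplacian G ρ hε]
  simp only [real_inner_comm]

theorem signedLaplacian_nonneg {ρ : ℝ} (hρ : 0 ≤ ρ) {ε : ℝ} (hε : ε * ε = 1)
    (z : PiLp 2 (fun _ : N => E)) : 0 ≤ ⟪signedLaplacian G E ρ ε z, z⟫ := by
  rw [inner_signedLaplacian G ρ hε]
  exact mul_nonneg (by positivity)
    (Finset.sum_nonneg fun i _ => Finset.sum_nonneg fun j _ => real_inner_self_nonneg)

theorem signedLaplacian_coercive (hdeg : ∀ i, 1 ≤ G.degree i) {ρ : ℝ} (hρ : 0 ≤ ρ)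
    (z : PiLp 2 (fun _ : N => E)) :
    2 * ρ * ‖z‖ ^ 2
      ≤ ⟪signedLaplacian G E ρ (-1) z, z⟫ + ⟪signedLaplacian G E ρ 1 z, z⟫ := by
  rw [← inner_add_left, PiLp.norm_sq_eq_of_L2, PiLp.inner_apply, Finset.mul_sum]
  refine Finset.sum_le_sum fun i _ => ?_
  have h : (signedLaplacian G E ρ (-1) z + signedLaplacian G E ρ 1 z) i
      = (2 * ρ * G.degree i) • z i := by
    rw [PiLp.add_apply, signedLaplacian_apply, signedLaplacian_apply, ← smul_add,
      ← Finset.sum_add_distrib]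
    have : ∀ j ∈ G.neighborFinset i, z i + (-1 : ℝ) • z j + (z i + (1 : ℝ) • z j)
        = (2 : ℝ) • z i := fun j _ => by module
    rw [Finset.sum_congr rfl this, Finset.sum_const, G.card_neighborFinset_eq_degree]
    module
  rw [h, real_inner_smul_left, real_inner_self_eq_norm_sq]
  have hd : (1 : ℝ) ≤ G.degree i := by exact_mod_cast hdeg i
  have : 2 * ρ * 1 ≤ 2 * ρ * (G.degree i : ℝ) := by gcongr
  nlinarith [sq_nonneg ‖z i‖]

theorem signedLaplacian_const (ρ : ℝ) (e : E) :
    signedLaplacian G E ρ (-1) (WithLp.toLp 2 fun _ => e) = 0 := by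
  ext i
  simp [signedLaplacian_apply]

theorem eq_of_signedLaplacian_eq_zero (hG : G.Connected) {ρ : ℝ} (hρ : 0 < ρ)
    {z : PiLp 2 (fun _ : N => E)} (hz : signedLaplacian G E ρ (-1) z = 0) (i j : N) :
    z i = z j := by
  have h := inner_signedLaplacian G ρ (ε := -1) (by norm_num) z z
  rw [hz, inner_zero_left, eq_comm, mul_eq_zero_iff_left (by positivity)] at h
  have hadj : ∀ i j, G.Adj i j → z i = z j := fun i j hij => by
    have h1 := (Finset.sum_eq_zero_iff_of_nonneg fun i _ =>
      Finset.sum_nonneg fun j _ => real_inner_self_nonneg).1 h i (Finset.mem_univ i)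
    have h2 := (Finset.sum_eq_zero_iff_of_nonneg fun j _ => real_inner_self_nonneg).1 h1 j
      (by simpa using hij)
    rw [inner_self_eq_zero] at h2
    rw [← sub_eq_zero, ← h2]; module
  obtain ⟨w⟩ := hG.preconnected i j
  induction w with
  | nil => rfl
  | cons hij _ ih => exact (hadj _ _ hij).trans ih

theorem exists_signedLaplacian_eq (hG : G.Connected) {ρ : ℝ} (hρ : 0 < ρ)
    {q : PiLp 2 (fun _ : N => E)} (hq : ∑ i, q i = 0) :
    ∃ s, signedLaplacian G E ρ (-1) s = q := by
  set L := signedLaplacian G E ρ (-1) with hL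
  have hsymm : ∀ a b, ⟪L a, b⟫ = ⟪a, L b⟫ := signedLaplacian_symm G ρ (by norm_num)
  suffices q ∈ L.toLinearMap.range from this
  rw [← Submodule.orthogonal_orthogonal L.toLinearMap.range,
    Submodule.mem_orthogonal]
  intro z hz
  have hLz : L z = 0 := by
    rw [← inner_self_eq_zero (𝕜 := ℝ), ← hsymm]
    exact (Submodule.mem_orthogonal _ _).1 hz _ ⟨L z, rfl⟩
  obtain ⟨i₀⟩ := hG.nonempty
  rw [PiLp.inner_apply]
  calc ∑ i, ⟪z i, q i⟫ = ∑ i, ⟪z i₀, q i⟫ := Finset.sum_congr rfl fun i _ => by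
        rw [eq_of_signedLaplacian_eq_zero G hG hρ hLz i i₀]
    _ = 0 := by rw [← inner_sum, hq, inner_zero_right]

theorem sum_signedLaplacian (ρ : ℝ) (s : PiLp 2 (fun _ : N => E)) :
    ∑ i, signedLaplacian G E ρ (-1) s i = 0 := by
  refine ext_inner_right ℝ fun e => ?_
  have h := signedLaplacian_symm G ρ (ε := -1) (by norm_num) s (WithLp.toLp 2 fun _ => e)
  rw [signedLaplacian_const, inner_zero_right, PiLp.inner_apply] at h
  rw [sum_inner, h, inner_zero_left]

end Graph

section EReal

theorem EReal.coe_finset_sum {ι : Type*} (s : Finset ι) (g : ι → ℝ) :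
    ((∑ i ∈ s, g i : ℝ) : EReal) = ∑ i ∈ s, (g i : EReal) :=
  map_sum (⟨⟨fun r : ℝ => (r : EReal), EReal.coe_zero⟩, EReal.coe_add⟩ : ℝ →+ EReal) g s

theorem EReal.finset_sum_ne_bot {ι : Type*} (s : Finset ι) (g : ι → EReal)
    (hg : ∀ i, g i ≠ ⊥) : ∑ i ∈ s, g i ≠ ⊥ := by
  classical
  induction s using Finset.induction_on with
  | empty => simp
  | insert a s ha ih =>
    rw [Finset.sum_insert ha]
    exact EReal.add_ne_bot_iff.2 ⟨hg a, ih⟩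

theorem EReal.finset_sum_eq_top {ι : Type*} {s : Finset ι} {g : ι → EReal}
    (hg : ∀ i, g i ≠ ⊥) {i : ι} (hi : i ∈ s) (h : g i = ⊤) : ∑ i ∈ s, g i = ⊤ := by
  classical
  rw [← Finset.add_sum_erase s g hi, h]
  exact EReal.top_add_of_ne_bot (EReal.finset_sum_ne_bot _ _ hg)

theorem EReal.exists_coe_eq {a : EReal} (h : a ≠ ⊤) (h' : a ≠ ⊥) : ∃ r : ℝ, a = r :=
  ⟨a.toReal, (EReal.coe_toReal h h').symm⟩

end EReal

section Convex

theorem nonneg_of_forall_add_mul_sq_nonneg {a B : ℝ}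
    (h : ∀ s : ℝ, 0 < s → s ≤ 1 → 0 ≤ s * a + s ^ 2 * B) : 0 ≤ a := by
  have h1 : Tendsto (fun s : ℝ => a + s * B) (𝓝[>] 0) (𝓝 a) := by
    have : Tendsto (fun s : ℝ => a + s * B) (𝓝 0) (𝓝 (a + 0 * B)) :=
      Continuous.tendsto (by fun_prop) 0
    rw [zero_mul, add_zero] at this
    exact this.mono_left nhdsWithin_le_nhds
  refine ge_of_tendsto h1 ?_
  filter_upwards [Ioc_mem_nhdsGT (zero_lt_one : (0 : ℝ) < 1)] with s hs
  have h2 := h s hs.1 hs.2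
  have h3 : s * a + s ^ 2 * B = s * (a + s * B) := by ring
  rw [h3] at h2
  exact nonneg_of_mul_nonneg_right h2 hs.1

variable {E : Type*} [NormedAddCommGroup E] [InnerProductSpace ℝ E]

theorem norm_add_smul_sq (w d : E) (s : ℝ) :
    ‖w + s • d‖ ^ 2 = ‖w‖ ^ 2 + s * (2 * ⟪w, d⟫) + s ^ 2 * ‖d‖ ^ 2 := by
  rw [norm_add_sq_real, real_inner_smul_right, norm_smul, mul_pow, Real.norm_eq_abs, sq_abs]
  ring

/-- Moreau decomposition: if `t` is the closest point of a convex cone `K` to `w`, then `w - t` is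
in the polar cone, orthogonal to `t`, and is the projection of `w` onto the polar cone. -/
theorem moreau_decomposition {K : Set E} (hK : Convex ℝ K)
    (hcone : ∀ c : ℝ, 0 < c → ∀ x ∈ K, c • x ∈ K) {w t : E} (ht : t ∈ K)
    (hmin : ∀ q ∈ K, ‖w - t‖ ^ 2 ≤ ‖w - q‖ ^ 2) :
    w - t ∈ polarSet K ∧ ⟪w - t, t⟫ = 0 ∧ projSet (polarSet K) w = w - t := by
  have hvar : ∀ q ∈ K, 0 ≤ ⟪w - t, t - q⟫ := fun q hq => by
    have : 0 ≤ 2 * ⟪w - t, t - q⟫ := by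
      refine nonneg_of_forall_add_mul_sq_nonneg (B := ‖t - q‖ ^ 2) fun s hs hs1 => ?_
      have hmem : (1 - s) • t + s • q ∈ K := hK ht hq (by linarith) hs.le (by ring)
      have h1 := hmin _ hmem
      rw [show w - ((1 - s) • t + s • q) = (w - t) + s • (t - q) by module,
        norm_add_smul_sq] at h1
      linarith
    linarith
  have horth : ⟪w - t, t⟫ = 0 := by
    have h1 := hvar _ (hcone 2 (by norm_num) t ht)
    have h2 := hvar _ (hcone (1 / 2) (by norm_num) t ht)
    rw [inner_sub_right, real_inner_smul_right] at h1 h2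
    linarith
  have hpolar : w - t ∈ polarSet K := fun q hq => by
    have h1 := hvar q hq
    rw [inner_sub_right, horth] at h1
    rw [real_inner_comm]; linarith
  have hdist : ∀ q ∈ polarSet K, ‖t‖ ^ 2 + ‖w - t - q‖ ^ 2 ≤ ‖w - q‖ ^ 2 := fun q hq => by
    have h1 := hq t ht
    rw [show w - q = t + (w - t - q) by abel, norm_add_sq_real, inner_sub_right,
      real_inner_comm, horth]
    linarith
  have hex : ∃ p ∈ polarSet K, ∀ q ∈ polarSet K, ‖w - p‖ ≤ ‖w - q‖ := by
    refine ⟨w - t, hpolar, fun q hq => ?_⟩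
    rw [sub_sub_cancel]
    exact (sq_le_sq₀ (norm_nonneg _) (norm_nonneg _)).1 (by nlinarith [hdist q hq, sq_nonneg ‖w - t - q‖])
  refine ⟨hpolar, horth, ?_⟩
  rw [projSet, dif_pos hex]
  obtain ⟨h1, h2⟩ := hex.choose_spec
  generalize hex.choose = p at h1 h2
  have h3 := h2 _ hpolar
  rw [sub_sub_cancel] at h3
  have h4 := hdist p h1
  have h5 : ‖w - p‖ ^ 2 ≤ ‖t‖ ^ 2 := by gcongr
  have h6 : ‖w - t - p‖ ^ 2 = 0 := le_antisymm (by linarith) (sq_nonneg _)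
  rw [sq_eq_zero_iff, norm_eq_zero, sub_eq_zero] at h6
  exact h6.symm

variable {X : Type*} [NormedAddCommGroup X] [InnerProductSpace ℝ X]

theorem prox_optimality {f : X → EReal} (hf : EConvexFn f) (A : X →ₗ[ℝ] E) {α : ℝ} {x : X} {r : E}
    {F : ℝ} (hF : f x = F)
    (hmin : ∀ v, f x + ((α * ‖A x + r‖ ^ 2 : ℝ) : EReal)
      ≤ f v + ((α * ‖A v + r‖ ^ 2 : ℝ) : EReal)) {v : X} {c : ℝ} (hc : f v = c) :
    F ≤ c + ⟪(2 * α) • (A x + r), A v - A x⟫ := by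
  have : 0 ≤ c - F + 2 * α * ⟪A x + r, A v - A x⟫ := by
    refine nonneg_of_forall_add_mul_sq_nonneg (B := α * ‖A v - A x‖ ^ 2) fun s hs hs1 => ?_
    have h1 := (hmin ((1 - s) • x + s • v)).trans
      (add_le_add_left (hf x v (1 - s) s (by linarith) hs.le (by ring)) _)
    rw [hF, hc] at h1
    norm_cast at h1
    rw [show A ((1 - s) • x + s • v) + r = (A x + r) + s • (A v - A x) by
      rw [map_add, map_smul, map_smul]; module, norm_add_smul_sq] at h1
    linarith
  rw [real_inner_smul_left]
  linarith

/-- `(x, t, y)` satisfies the optimality conditions of a single agent: `f x = F` is finite,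
`-Aᵀ y` is a subgradient of `f` at `x`, and `y` lies in the normal cone of `K` at `t`. -/
structure IsAgentKKT (f : X → EReal) (A : X →ₗ[ℝ] E) (K : Set E) (x : X) (t y : E) (F : ℝ) :
    Prop where
  value : f x = F
  subgradient : ∀ (v : X) (c : ℝ), f v = c → F ≤ c + ⟪y, A v - A x⟫
  mem : t ∈ K
  mem_polar : y ∈ polarSet K
  orth : ⟪y, t⟫ = 0

theorem IsAgentKKT.monotone {f : X → EReal} {A : X →ₗ[ℝ] E} {K : Set E} {x x' : X} {t t' y y' : E}
    {F F' : ℝ} (h : IsAgentKKT f A K x t y F) (h' : IsAgentKKT f A K x' t' y' F') (b : E) :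
    0 ≤ ⟪(t + b - A x) - (t' + b - A x'), y - y'⟫ := by
  have h1 := h.subgradient x' F' h'.value
  have h2 := h'.subgradient x F h.value
  have h3 := h.mem_polar t' h'.mem
  have h4 := h'.mem_polar t h.mem
  have h5 := h.orth
  have h6 := h'.orth
  rw [real_inner_comm] at h3 h4
  rw [real_inner_comm]
  simp only [inner_sub_left, inner_sub_right, inner_add_right] at *
  linarith

theorem isAgentKKT_of_isMin {f : X → EReal} (hf : EConvexFn f) (hproper : EProper f)
    (A : X →ₗ[ℝ] E) {K : Set E} (hK : Convex ℝ K)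
    (hcone : ∀ c : ℝ, 0 < c → ∀ x ∈ K, c • x ∈ K) {α : ℝ} (hα : 0 < α) {x : X} {r t : E}
    (ht : t ∈ K) (hmin : ∀ v, ∀ q ∈ K, f x + ((α * ‖A x + r - t‖ ^ 2 : ℝ) : EReal)
      ≤ f v + ((α * ‖A v + r - q‖ ^ 2 : ℝ) : EReal)) :
    (∃ F, IsAgentKKT f A K x t ((2 * α) • (A x + r - t)) F) ∧
      projSet (polarSet K) (A x + r) = A x + r - t := by
  obtain ⟨F, hF⟩ : ∃ F : ℝ, f x = F := by
    refine EReal.exists_coe_eq (fun htop => ?_) (hproper.1 x)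
    obtain ⟨v, hv⟩ := hproper.2
    obtain ⟨c, hc⟩ := EReal.exists_coe_eq hv (hproper.1 v)
    have h1 := hmin v t ht
    rw [htop, hc, EReal.top_add_coe, ← EReal.coe_add] at h1
    exact EReal.coe_ne_top _ (top_le_iff.1 h1)
  obtain ⟨h1, h2, h3⟩ := moreau_decomposition hK hcone (w := A x + r) ht fun q hq => by
    have h := hmin x q hq
    rw [hF] at h
    norm_cast at h
    exact le_of_mul_le_mul_left (by linarith) hα
  refine ⟨⟨F, hF, fun v c hc => ?_, ht, fun q hq => ?_, ?_⟩, h3⟩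
  · have := prox_optimality hf A (r := r - t) (α := α) hF
      (fun v => by simpa only [add_sub_assoc] using hmin v t ht) hc
    rwa [← add_sub_assoc] at this
  · rw [real_inner_smul_right]
    exact mul_nonpos_of_nonneg_of_nonpos (by positivity) (h1 q hq)
  · rw [real_inner_smul_left, h2, mul_zero]

theorem econj_ne_bot {f : X → EReal} (hf : EProper f) (y : X) : econj f y ≠ ⊥ := by
  obtain ⟨v, hv⟩ := hf.2
  obtain ⟨c, hc⟩ := EReal.exists_coe_eq hv (hf.1 v)
  intro h
  have h1 : ((⟪y, v⟫ : ℝ) : EReal) - f v ≤ ⊥ :=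
    h ▸ le_iSup (fun v => ((⟪y, v⟫ : ℝ) : EReal) - f v) v
  rw [hc, ← EReal.coe_sub, le_bot_iff] at h1
  exact EReal.coe_ne_bot _ h1

variable [FiniteDimensional ℝ X] [FiniteDimensional ℝ E]

theorem fenchel_young {f : X → EReal} (A : X →ₗ[ℝ] E) {y : E} {e : ℝ}
    (he : econj f (-(LinearMap.adjoint A y)) = e) {v : X} {c : ℝ} (hc : f v = c) :
    -⟪y, A v⟫ - c ≤ e := by
  have h : ((⟪-(LinearMap.adjoint A y), v⟫ : ℝ) : EReal) - f v ≤ e :=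
    he ▸ le_iSup (fun v => ((⟪-(LinearMap.adjoint A y), v⟫ : ℝ) : EReal) - f v) v
  rw [hc, inner_neg_left, LinearMap.adjoint_inner_left] at h
  exact_mod_cast h

theorem econj_le_coe {f : X → EReal} (hf : ∀ x, f x ≠ ⊥) (A : X →ₗ[ℝ] E) {y : E} {e : ℝ}
    (h : ∀ (v : X) (c : ℝ), f v = c → -⟪y, A v⟫ - c ≤ e) :
    econj f (-(LinearMap.adjoint A y)) ≤ e := by
  refine iSup_le fun v => ?_
  by_cases hv : f v = ⊤
  · rw [hv]; simp
  · obtain ⟨c, hc⟩ := EReal.exists_coe_eq hv (hf v)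
    rw [hc, inner_neg_left, LinearMap.adjoint_inner_left]
    exact_mod_cast h v c hc

theorem IsAgentKKT.dual_bound {f : X → EReal} {A : X →ₗ[ℝ] E} {K : Set E} {x : X} {t y y' : E}
    {F e : ℝ} (h : IsAgentKKT f A K x t y F) (hy' : y' ∈ polarSet K)
    (he : econj f (-(LinearMap.adjoint A y')) = e) (b : E) {v : X} {c : ℝ} (hc : f v = c) :
    -⟪y, A v⟫ - c ≤ e + ⟪y' - y, b - (t + b - A x)⟫ := by
  have h1 := h.subgradient v c hc
  have h2 := fenchel_young A he h.value
  have h3 := hy' t h.mem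
  have h4 := h.orth
  rw [real_inner_comm] at h3
  simp only [inner_sub_left, inner_sub_right, inner_add_right] at *
  linarith

end Convex

section Duality

theorem sum_mem_of_convex_cone {E : Type*} [AddCommGroup E] [Module ℝ E] {K : Set E}
    (hK : Convex ℝ K) (hcone : ∀ c : ℝ, 0 < c → ∀ x ∈ K, c • x ∈ K) {ι : Type*} {s : Finset ι}
    (hs : s.Nonempty) {g : ι → E} (hg : ∀ i ∈ s, g i ∈ K) : ∑ i ∈ s, g i ∈ K := by
  have hadd : ∀ x ∈ K, ∀ y ∈ K, x + y ∈ K := fun x hx y hy => by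
    have h := hcone 2 two_pos _
      (hK hx hy (by norm_num : (0 : ℝ) ≤ 1 / 2) (by norm_num : (0 : ℝ) ≤ 1 / 2) (by norm_num))
    rwa [smul_add, smul_smul, smul_smul, mul_one_div_cancel two_ne_zero, one_smul, one_smul] at h
  exact Finset.sum_induction_nonempty g (· ∈ K) (fun x y hx hy => hadd x hx y hy) hs hg

variable {N : Type*} [Fintype N] {X : N → Type*} [∀ i, NormedAddCommGroup (X i)]
  [∀ i, InnerProductSpace ℝ (X i)] {E : Type*} [NormedAddCommGroup E] [InnerProductSpace ℝ E]
  {f : ∀ i, X i → EReal} {A : ∀ i, X i →ₗ[ℝ] E} {b : N → E} {K : Set E}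

theorem sum_le_sum_of_subgradient (hf : ∀ i x, f i x ≠ ⊥) {x : ∀ i, X i} {y : E}
    (hsub : ∀ i (v : X i) (c : ℝ), f i v = c →
      f i (x i) ≤ ((c + ⟪y, A i v - A i (x i)⟫ : ℝ) : EReal))
    (hy : y ∈ polarSet K) (horth : ⟪y, ∑ i, (A i (x i) - b i)⟫ = 0) {x' : ∀ i, X i}
    (hx' : ∑ i, (A i (x' i) - b i) ∈ K) : ∑ i, f i (x i) ≤ ∑ i, f i (x' i) := by
  by_cases htop : ∃ i, f i (x' i) = ⊤
  · obtain ⟨i, hi⟩ := htop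
    rw [EReal.finset_sum_eq_top (fun i => hf i (x' i)) (Finset.mem_univ i) hi]
    exact le_top
  push Not at htop
  choose c hc using fun i => EReal.exists_coe_eq (htop i) (hf i (x' i))
  refine (Finset.sum_le_sum fun i _ => hsub i (x' i) (c i) (hc i)).trans ?_
  simp only [hc, ← EReal.coe_finset_sum, EReal.coe_le_coe_iff]
  rw [Finset.sum_add_distrib, ← inner_sum]
  have h1 := hy _ hx'
  rw [real_inner_comm] at h1
  have h2 : ∑ i, (A i (x' i) - A i (x i))
      = ∑ i, (A i (x' i) - b i) - ∑ i, (A i (x i) - b i) := by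
    rw [← Finset.sum_sub_distrib]
    exact Finset.sum_congr rfl fun i _ => by abel
  rw [h2, inner_sub_right, horth]
  linarith

variable [∀ i, FiniteDimensional ℝ (X i)] [FiniteDimensional ℝ E]

/-- The negated dual objective. -/
noncomputable def dualCost (f : ∀ i, X i → EReal) (A : ∀ i, X i →ₗ[ℝ] E) (b : N → E) (y : E) :
    EReal :=
  ∑ i, (econj (f i) (-(LinearMap.adjoint (A i) y)) + ((⟪y, b i⟫ : ℝ) : EReal))

theorem dualCost_le_dualCost (hf : ∀ i, EProper (f i)) {y y' : E} {u : N → E} (hu : ∑ i, u i = 0)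
    (h : ∀ i (e : ℝ), econj (f i) (-(LinearMap.adjoint (A i) y')) = e →
      econj (f i) (-(LinearMap.adjoint (A i) y)) ≤ ((e + ⟪y' - y, b i - u i⟫ : ℝ) : EReal)) :
    dualCost f A b y ≤ dualCost f A b y' := by
  have hbot : ∀ i, econj (f i) (-(LinearMap.adjoint (A i) y')) ≠ ⊥ :=
    fun i => econj_ne_bot (hf i) _
  by_cases htop : ∃ i, econj (f i) (-(LinearMap.adjoint (A i) y')) = ⊤
  · obtain ⟨i, hi⟩ := htop
    rw [dualCost, dualCost, EReal.finset_sum_eq_top (i := i) (s := Finset.univ)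
      (g := fun i => econj (f i) (-(LinearMap.adjoint (A i) y')) + ((⟪y', b i⟫ : ℝ) : EReal))
      (fun i => EReal.add_ne_bot_iff.2 ⟨hbot i, EReal.coe_ne_bot _⟩) (Finset.mem_univ i)
      (by simp only [hi, EReal.top_add_coe])]
    exact le_top
  push Not at htop
  choose e he using fun i => EReal.exists_coe_eq (htop i) (hbot i)
  calc dualCost f A b y
      ≤ ∑ i, (((e i + ⟪y' - y, b i - u i⟫ : ℝ) : EReal) + ((⟪y, b i⟫ : ℝ) : EReal)) :=
        Finset.sum_le_sum fun i _ => add_le_add_left (h i (e i) (he i)) _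
    _ = dualCost f A b y' := by
      simp only [dualCost, he, ← EReal.coe_add, ← EReal.coe_finset_sum, EReal.coe_eq_coe_iff]
      have h1 : ∀ i, e i + ⟪y' - y, b i - u i⟫ + ⟪y, b i⟫
          = e i + ⟪y', b i⟫ - ⟪y' - y, u i⟫ := fun i => by
        simp only [inner_sub_left, inner_sub_right]; ring
      simp only [h1]
      rw [Finset.sum_sub_distrib, ← inner_sum, hu, inner_zero_right, sub_zero]

theorem exists_isAgentKKT_of_zero_gap [Nonempty N] (hf : ∀ i, EProper (f i))
    (hcone : ∀ c : ℝ, 0 < c → ∀ x ∈ K, c • x ∈ K) {x : ∀ i, X i} {y : E}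
    (hx : ∑ i, (A i (x i) - b i) ∈ K) (hy : y ∈ polarSet K)
    (hgap : ∑ i, f i (x i) = -dualCost f A b y) (htop : ∑ i, f i (x i) ≠ ⊤) :
    ∃ F : N → ℝ, ∀ i, IsAgentKKT (f i) (A i) K (x i)
      ((Fintype.card N : ℝ)⁻¹ • ∑ i, (A i (x i) - b i)) y (F i) := by
  choose F hF using fun i => EReal.exists_coe_eq
    (fun h => htop (EReal.finset_sum_eq_top (fun i => (hf i).1 (x i)) (Finset.mem_univ i) h))
    ((hf i).1 (x i))
  have hbot : ∀ i, econj (f i) (-(LinearMap.adjoint (A i) y)) ≠ ⊥ :=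
    fun i => econj_ne_bot (hf i) _
  have hFsum : ∑ i, f i (x i) = ((∑ i, F i : ℝ) : EReal) := by
    simp only [hF, EReal.coe_finset_sum]
  choose e he using fun i => EReal.exists_coe_eq (fun h => by
    have h1 : dualCost f A b y = ⊤ := EReal.finset_sum_eq_top (i := i)
      (g := fun i => econj (f i) (-(LinearMap.adjoint (A i) y)) + ((⟪y, b i⟫ : ℝ) : EReal))
      (fun i => EReal.add_ne_bot_iff.2 ⟨hbot i, EReal.coe_ne_bot _⟩) (Finset.mem_univ i)
      (by simp only [h, EReal.top_add_coe])
    rw [h1, hFsum, EReal.neg_top] at hgap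
    exact EReal.coe_ne_bot _ hgap) (hbot i)
  have hsum : ∑ i, F i = -∑ i, (e i + ⟪y, b i⟫) := by
    rw [hFsum] at hgap
    simp only [dualCost, he, ← EReal.coe_add, ← EReal.coe_finset_sum, ← EReal.coe_neg,
      EReal.coe_eq_coe_iff] at hgap
    exact hgap
  have hδ : ∀ i, 0 ≤ e i + F i + ⟪y, A i (x i)⟫ := fun i => by
    linarith [fenchel_young (A i) (he i) (hF i)]
  have hδsum : ∑ i, (e i + F i + ⟪y, A i (x i)⟫) = ⟪y, ∑ i, (A i (x i) - b i)⟫ := by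
    rw [inner_sum]
    simp only [inner_sub_right, Finset.sum_add_distrib, Finset.sum_sub_distrib] at hsum ⊢
    linarith
  have hle : ⟪y, ∑ i, (A i (x i) - b i)⟫ ≤ 0 := by
    rw [real_inner_comm]; exact hy _ hx
  have h0 : ∑ i, (e i + F i + ⟪y, A i (x i)⟫) = 0 :=
    le_antisymm (hδsum.trans_le hle) (Finset.sum_nonneg fun i _ => hδ i)
  have hδ0 := (Finset.sum_eq_zero_iff_of_nonneg fun i _ => hδ i).1 h0
  refine ⟨F, fun i => ⟨hF i, fun v c hc => ?_, ?_, hy, ?_⟩⟩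
  · have h1 := fenchel_young (A i) (he i) hc
    have h2 := hδ0 i (Finset.mem_univ i)
    rw [inner_sub_right]
    linarith
  · exact hcone _ (inv_pos.2 (by exact_mod_cast Fintype.card_pos)) _ hx
  · rw [real_inner_smul_right, ← hδsum, h0, mul_zero]

end Duality

/-- **Proposition 1.** Convergence of the aggregate dual consensus ADMM:
the dual iterates `yᵢᵏ` of Algorithm 2 all converge to a maximizer `y*` of the
dual problem (D), and every limit point of the concatenated primal iterates
`(xᵢᵏ)ᵢ` is a minimizer of the primal problem (P). -/
theorem aggregate_dual_consensus_admm_convergence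
    {N : Type*} [Fintype N] [Nonempty N] {m : ℕ} {n : N → ℕ}
    (G : SimpleGraph N) [DecidableRel G.Adj]
    (hGconn : G.Connected) (hdeg : ∀ i, 1 ≤ G.degree i)
    (f : ∀ i, EuclideanSpace ℝ (Fin (n i)) → EReal)
    (hconv : ∀ i, EConvexFn (f i)) (hlsc : ∀ i, LowerSemicontinuous (f i))
    (hproper : ∀ i, EProper (f i))
    (A : ∀ i, EuclideanSpace ℝ (Fin (n i)) →ₗ[ℝ] EuclideanSpace ℝ (Fin m))
    (b : N → EuclideanSpace ℝ (Fin m))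
    (K : Set (EuclideanSpace ℝ (Fin m)))
    (hne : K.Nonempty) (hcl : IsClosed K) (hKconv : Convex ℝ K)
    (hcone : ∀ c : ℝ, 0 < c → ∀ x ∈ K, c • x ∈ K)
    -- a primal-dual solution exists and the duality gap is zero
    (hgap : ∃ (xbar : ∀ i, EuclideanSpace ℝ (Fin (n i)))
        (ybar : EuclideanSpace ℝ (Fin m)),
        (∑ i, (A i (xbar i) - b i)) ∈ K ∧ ybar ∈ polarSet K ∧
        (∑ i, f i (xbar i))
          = -(∑ i, (econj (f i) (-(LinearMap.adjoint (A i) ybar))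
              + ((⟪ybar, b i⟫ : ℝ) : EReal))) ∧
        (∑ i, f i (xbar i)) ≠ ⊤ ∧ (∑ i, f i (xbar i)) ≠ ⊥)
    (ρ : ℝ) (hρ : 0 < ρ)
    (p r y t : N → ℕ → EuclideanSpace ℝ (Fin m))
    (x : ∀ i, ℕ → EuclideanSpace ℝ (Fin (n i)))
    (hp0 : ∀ i, p i 0 = 0)
    (hp : ∀ i k, p i (k + 1)
      = p i k + ρ • ∑ j ∈ G.neighborFinset i, (y i k - y j k))
    (hr : ∀ i k, r i (k + 1)
      = ρ • ∑ j ∈ G.neighborFinset i, (y i k + y j k) - (b i + p i (k + 1)))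
    (hmin : ∀ i k, t i (k + 1) ∈ K ∧
      ∀ xi : EuclideanSpace ℝ (Fin (n i)), ∀ ti ∈ K,
        f i (x i (k + 1)) + (((1 / (4 * ρ * (G.degree i : ℝ)))
            * ‖A i (x i (k + 1)) + r i (k + 1) - t i (k + 1)‖ ^ 2 : ℝ) : EReal)
          ≤ f i xi + (((1 / (4 * ρ * (G.degree i : ℝ)))
            * ‖A i xi + r i (k + 1) - ti‖ ^ 2 : ℝ) : EReal))
    (hy : ∀ i k, y i (k + 1)
      = (1 / (2 * ρ * (G.degree i : ℝ)))
          • projSet (polarSet K) (A i (x i (k + 1)) + r i (k + 1))) :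
    (∃ ystar : EuclideanSpace ℝ (Fin m),
      (ystar ∈ polarSet K ∧
        ∀ y' ∈ polarSet K,
          -(∑ i, (econj (f i) (-(LinearMap.adjoint (A i) y'))
              + ((⟪y', b i⟫ : ℝ) : EReal)))
            ≤ -(∑ i, (econj (f i) (-(LinearMap.adjoint (A i) ystar))
              + ((⟪ystar, b i⟫ : ℝ) : EReal)))) ∧
      (∀ i, Tendsto (fun k => y i k) atTop (nhds ystar))) ∧
    (∀ xl : ∀ i, EuclideanSpace ℝ (Fin (n i)),
      MapClusterPt xl atTop (fun k => fun i => x i k) →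
      ((∑ i, (A i (xl i) - b i)) ∈ K ∧
        ∀ x' : ∀ i, EuclideanSpace ℝ (Fin (n i)),
          (∑ i, (A i (x' i) - b i)) ∈ K → (∑ i, f i (xl i)) ≤ ∑ i, f i (x' i))) := by
  have hρd : ∀ i, 0 < ρ * (G.degree i : ℝ) := fun i =>
    mul_pos hρ (by exact_mod_cast hdeg i)
  have hstep : ∀ i k, (∃ F, IsAgentKKT (f i) (A i) K (x i (k + 1)) (t i (k + 1)) (y i (k + 1)) F) ∧
      (2 * ρ * (G.degree i : ℝ)) • y i (k + 1)
        = A i (x i (k + 1)) + r i (k + 1) - t i (k + 1) := fun i k => by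
    obtain ⟨h1, h2⟩ := isAgentKKT_of_isMin (hconv i) (hproper i) (A i) hKconv hcone
      (α := 1 / (4 * ρ * (G.degree i : ℝ))) (by have := hρd i; rw [mul_assoc]; positivity)
      (hmin i k).1 (hmin i k).2
    have hpos := hρd i
    have h3 : 2 * (1 / (4 * ρ * (G.degree i : ℝ))) = 1 / (2 * ρ * (G.degree i : ℝ)) := by
      rw [mul_assoc, mul_assoc]; field_simp; norm_num
    have h4 := hy i k
    rw [h2] at h4
    rw [h3, ← h4] at h1
    refine ⟨h1, ?_⟩
    rw [h4, smul_smul, mul_one_div_cancel (by rw [mul_assoc]; positivity), one_smul]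
  choose F hF using fun i k => (hstep i k).1
  set L := signedLaplacian G (EuclideanSpace ℝ (Fin m)) ρ (-1) with hLdef
  set Q := signedLaplacian G (EuclideanSpace ℝ (Fin m)) ρ 1 with hQdef
  let Y : ℕ → PiLp 2 (fun _ : N => EuclideanSpace ℝ (Fin m)) :=
    fun k => WithLp.toLp 2 fun i => y i k
  let S : ℕ → PiLp 2 (fun _ : N => EuclideanSpace ℝ (Fin m)) :=
    fun k => ∑ l ∈ Finset.range k, Y l
  let U : ℕ → PiLp 2 (fun _ : N => EuclideanSpace ℝ (Fin m)) :=
    fun k => WithLp.toLp 2 fun i => t i (k + 1) + b i - A i (x i (k + 1))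
  have hS : ∀ k, S (k + 1) = S k + Y k := fun k => Finset.sum_range_succ _ _
  have hLY : ∀ i k, L (Y k) i = ρ • ∑ j ∈ G.neighborFinset i, (y i k - y j k) := fun i k => by
    simp only [hLdef, signedLaplacian_apply, Y, neg_smul, one_smul, sub_eq_add_neg]
  have hpS : ∀ k i, p i k = L (S k) i := fun k => by
    induction k with
    | zero => intro i; simp [hp0, S]
    | succ k ih => intro i; rw [hp, ih, hS, map_add, PiLp.add_apply, hLY]
  have hU : ∀ k, U k + L (S (k + 2)) + Q (Y (k + 1) - Y k) = 0 := fun k => by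
    ext1 i
    have h1 := (hstep i k).2
    rw [hr] at h1
    have h2 : ∀ l, ∑ j ∈ G.neighborFinset i, (y i l - y j l)
        = (G.degree i : ℝ) • y i l - ∑ j ∈ G.neighborFinset i, y j l := fun l => by
      rw [Finset.sum_sub_distrib, Finset.sum_const, G.card_neighborFinset_eq_degree,
        Nat.cast_smul_eq_nsmul]
    have h3 : ∀ l, ∑ j ∈ G.neighborFinset i, (y i l + y j l)
        = (G.degree i : ℝ) • y i l + ∑ j ∈ G.neighborFinset i, y j l := fun l => by
      rw [Finset.sum_add_distrib, Finset.sum_const, G.card_neighborFinset_eq_degree,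
        Nat.cast_smul_eq_nsmul]
    have h4 : ∀ l, Q (Y l) i = ρ • ∑ j ∈ G.neighborFinset i, (y i l + y j l) := fun l => by
      simp only [hQdef, signedLaplacian_apply, Y, one_smul]
    have h5 : U k i = t i (k + 1) + b i - A i (x i (k + 1)) := rfl
    have h6 : A i (x i (k + 1)) = (2 * ρ * (G.degree i : ℝ)) • y i (k + 1) + t i (k + 1)
        - (ρ • ∑ j ∈ G.neighborFinset i, (y i k + y j k) - (b i + p i (k + 1))) := by
      rw [h1]; abel
    rw [PiLp.add_apply, PiLp.add_apply, hS (k + 1), map_add, PiLp.add_apply, ← hpS, hLY, map_sub,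
      PiLp.sub_apply, h4, h4, h5, h6, h2, h3, h3, PiLp.zero_apply]
    module
  have hmono : ∀ k l, 0 ≤ ⟪U k - U l, Y (k + 1) - Y (l + 1)⟫ := fun k l => by
    rw [PiLp.inner_apply]
    exact Finset.sum_nonneg fun i _ => (hF i k).monotone (hF i l) (b i)
  obtain ⟨xbar, ybar, hxK, hyK, heq, hntop, -⟩ := hgap
  obtain ⟨Fbar, hFbar⟩ := exists_isAgentKKT_of_zero_gap hproper hcone hxK hyK heq hntop
  set tbar := (Fintype.card N : ℝ)⁻¹ • ∑ i, (A i (xbar i) - b i) with htbar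
  have hsumbar : ∑ i, (tbar + b i - A i (xbar i)) = 0 := by
    have h1 : ∀ i, tbar + b i - A i (xbar i) = tbar - (A i (xbar i) - b i) := fun i => by abel
    simp only [h1]
    rw [Finset.sum_sub_distrib, Finset.sum_const, Finset.card_univ, htbar,
      ← Nat.cast_smul_eq_nsmul ℝ, smul_smul, mul_inv_cancel₀ (by simp), one_smul, sub_self]
  obtain ⟨sbar, hsbar⟩ := exists_signedLaplacian_eq G hGconn hρ
    (q := WithLp.toLp 2 fun i => -(tbar + b i - A i (xbar i)))
    (by simp only [Finset.sum_neg_distrib, hsumbar, neg_zero])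
  have href : ∀ k, 0 ≤ ⟪U k + L sbar, Y (k + 1) - WithLp.toLp 2 fun _ => ybar⟫ := fun k => by
    rw [hLdef, hsbar, PiLp.inner_apply]
    refine Finset.sum_nonneg fun i _ => ?_
    have := (hF i k).monotone (hFbar i) (b i)
    rwa [sub_eq_add_neg _ (tbar + b i - A i (xbar i))] at this
  obtain ⟨ylim, slim, hLylim, hYlim, hUlim⟩ := lyapunov_convergence L Q
    (signedLaplacian_symm G ρ (by norm_num)) (signedLaplacian_symm G ρ (by norm_num))
    (signedLaplacian_nonneg G hρ.le (by norm_num)) (signedLaplacian_nonneg G hρ.le (by norm_num))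
    (by positivity : 0 < 2 * ρ) (signedLaplacian_coercive G hdeg hρ.le)
    Y S U hS hU hmono _ sbar (signedLaplacian_const G ρ ybar) href
  obtain ⟨i₀⟩ := ‹Nonempty N›
  set ystar := ylim i₀ with hystar
  set ulim : N → EuclideanSpace ℝ (Fin m) := fun i => (-(L slim)) i with hulimdef
  have hulim : ∑ i, ulim i = 0 := by
    simp only [hulimdef, PiLp.neg_apply, Finset.sum_neg_distrib, hLdef, sum_signedLaplacian,
      neg_zero]
  have hy_lim : ∀ i, Tendsto (fun k => y i k) atTop (𝓝 ystar) := fun i => by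
    rw [hystar, eq_of_signedLaplacian_eq_zero G hGconn hρ hLylim i₀ i]
    exact ((PiLp.continuous_apply 2 _ i).tendsto ylim).comp hYlim
  have hu_lim : ∀ i, Tendsto (fun k => t i (k + 1) + b i - A i (x i (k + 1))) atTop
      (𝓝 (ulim i)) := fun i => ((PiLp.continuous_apply 2 _ i).tendsto _).comp hUlim
  have hy_lim' : ∀ i, Tendsto (fun k => y i (k + 1)) atTop (𝓝 ystar) := fun i =>
    (tendsto_add_atTop_iff_nat 1).2 (hy_lim i)
  have hpolar : ystar ∈ polarSet K := fun q hq =>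
    le_of_tendsto' (tendsto_const_nhds.inner (hy_lim' i₀)) fun k => (hF i₀ k).mem_polar q hq
  refine ⟨⟨ystar, ⟨hpolar, fun y' hy' => ?_⟩, hy_lim⟩, fun xl hxl => ?_⟩
  · rw [EReal.neg_le_neg_iff]
    refine dualCost_le_dualCost hproper hulim fun i e he => ?_
    refine econj_le_coe (hproper i).1 (A i) fun v c hc => ?_
    exact le_of_tendsto_of_tendsto' (((hy_lim' i).inner tendsto_const_nhds).neg.sub_const c)
      (((tendsto_const_nhds.sub (hy_lim' i)).inner
        (tendsto_const_nhds.sub (hu_lim i))).const_add e)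
      fun k => (hF i k).dual_bound hy' he (b i) hc
  · rw [MapClusterPt, ← map_add_atTop_eq_nat 1, map_map] at hxl
    obtain ⟨l, hl, hxlim⟩ := mapClusterPt_iff_ultrafilter.1 hxl
    have hAx : ∀ i, Tendsto (fun k => A i (x i (k + 1))) l (𝓝 (A i (xl i))) := fun i =>
      ((A i).continuous_of_finiteDimensional.tendsto _).comp (tendsto_pi_nhds.1 hxlim i)
    have ht : ∀ i, Tendsto (fun k => t i (k + 1)) l (𝓝 (ulim i + (A i (xl i) - b i))) :=
      fun i => (((hu_lim i).mono_left hl).add ((hAx i).sub_const (b i))).congr fun k => by abel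
    have hyl : ∀ i, Tendsto (fun k => y i (k + 1)) l (𝓝 ystar) := fun i =>
      (hy_lim' i).mono_left hl
    have htK : ∀ i, ulim i + (A i (xl i) - b i) ∈ K := fun i =>
      hcl.mem_of_tendsto (ht i) (Eventually.of_forall fun k => (hF i k).mem)
    have horth : ∀ i, ⟪ystar, ulim i + (A i (xl i) - b i)⟫ = 0 := fun i =>
      tendsto_nhds_unique ((hyl i).inner (ht i))
        (tendsto_const_nhds.congr fun k => (hF i k).orth.symm)
    have hsum : ∑ i, (ulim i + (A i (xl i) - b i)) = ∑ i, (A i (xl i) - b i) := by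
      rw [Finset.sum_add_distrib, hulim, zero_add]
    have hfeas : ∑ i, (A i (xl i) - b i) ∈ K := by
      rw [← hsum]
      exact sum_mem_of_convex_cone hKconv hcone ⟨i₀, Finset.mem_univ i₀⟩ fun i _ => htK i
    refine ⟨hfeas, fun x' hx' => sum_le_sum_of_subgradient (fun i => (hproper i).1)
      (fun i v c hc => ?_) hpolar ?_ hx'⟩
    · have hbound : Tendsto (fun k =>
          ((c + ⟪y i (k + 1), A i v - A i (x i (k + 1))⟫ : ℝ) : EReal)) l
          (𝓝 ((c + ⟪ystar, A i v - A i (xl i)⟫ : ℝ) : EReal)) :=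
        (continuous_coe_real_ereal.tendsto _).comp
          (((hyl i).inner (tendsto_const_nhds.sub (hAx i))).const_add c)
      refine le_of_forall_lt_imp_le_of_dense fun z hz => ge_of_tendsto hbound ?_
      filter_upwards [(tendsto_pi_nhds.1 hxlim i).eventually (hlsc i (xl i) z hz)] with k hk
      refine hk.le.trans ?_
      simp only [Function.comp_apply, (hF i k).value]
      exact_mod_cast (hF i k).subgradient v c hc
    · rw [← hsum, inner_sum]
      exact Finset.sum_eq_zero fun i _ => horth i
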